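/- Let G be a hyperbolic group with finite generating set A, let d ∈ V^A(p,γ,T) be a visual metric on G, and let φ be an endomorphism of G with Gφ ≠ {1}. If φ satisfies a Hölder condition as a map from (G,d) to (G,d), then the kernel of φ is finite and the image subgroup Gφ is a quasiconvex subgroup of G with respect to A. -/

import Mathlib

open scoped Classical

section Defs

variable {G : Type*}

/-- Word length of `g` with respect to a generating set `A`: the least `n` such that
`g` is a product of `n` elements of `A ∪ A⁻¹`. -/
noncomputable def wordLength [Group G] (A : Set G) (g : G) : ℕ :=
  sInf {n : ℕ | ∃ w : List G, w.length = n ∧ (∀ x ∈ w, x ∈ A ∨ x⁻¹ ∈ A) ∧ w.prod = g}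

/-- The word metric `d_A(g,h)` (as a real number). -/
noncomputable def wordDist [Group G] (A : Set G) (g h : G) : ℝ :=
  (wordLength A (g⁻¹ * h) : ℝ)

/-- The Gromov product `(x|y)_p` with respect to a distance function `d`. -/
noncomputable def gromov {X : Type*} (d : X → X → ℝ) (p x y : X) : ℝ :=
  (d p x + d p y - d x y) / 2

/-- `G` is `δ`-hyperbolic with respect to the generating set `A`. -/
def IsHyperbolicWith [Group G] (A : Set G) (δ : ℝ) : Prop :=
  ∀ p g₀ g₁ g₂ : G,
    min (gromov (wordDist A) p g₀ g₁) (gromov (wordDist A) p g₁ g₂) - δ ≤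
      gromov (wordDist A) p g₀ g₂

/-- `G` is hyperbolic with respect to the generating set `A`. -/
def IsHyperbolic [Group G] (A : Set G) : Prop :=
  ∃ δ : ℝ, 0 ≤ δ ∧ IsHyperbolicWith A δ

/-- `ρ_{p,γ}(g,h) = e^{-γ (g|h)_p}` (and `0` on the diagonal), with respect to a
distance function `dA`. -/
noncomputable def visualRhoOf {X : Type*} (dA : X → X → ℝ) (p : X) (γ : ℝ) (g h : X) : ℝ :=
  if g = h then 0 else Real.exp (-γ * gromov dA p g h)

/-- `d` is a metric on `X`. -/
structure IsMetric {X : Type*} (d : X → X → ℝ) : Prop where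
  refl : ∀ x, d x x = 0
  eq_of : ∀ x y, d x y = 0 → x = y
  symm : ∀ x y, d x y = d y x
  triangle : ∀ x y z, d x z ≤ d x y + d y z

/-- `d` is a visual metric in `V(p,γ,T)` with respect to the distance function `dA`. -/
def InVisualOf {X : Type*} (dA : X → X → ℝ) (p : X) (γ T : ℝ) (d : X → X → ℝ) : Prop :=
  IsMetric d ∧ ∀ g h : X, g ≠ h →
    visualRhoOf dA p γ g h / T ≤ d g h ∧ d g h ≤ T * visualRhoOf dA p γ g h

/-- `d ∈ V^A(p,γ,T)`: `d` is a visual metric with respect to the word metric `d_A`. -/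
def InVisual [Group G] (A : Set G) (p : G) (γ T : ℝ) (d : G → G → ℝ) : Prop :=
  InVisualOf (wordDist A) p γ T d

/-- `φ : (X,d) → (X,d')` satisfies a Hölder condition of exponent `r`. -/
def HolderCondWith {X : Type*} (d d' : X → X → ℝ) (φ : X → X) (r : ℝ) : Prop :=
  ∃ K : ℝ, 0 < K ∧ ∀ g h : X, d' (φ g) (φ h) ≤ K * d g h ^ r

/-- `φ : (X,d) → (X,d')` satisfies a Hölder condition (of some positive exponent). -/
def SatisfiesHolder {X : Type*} (d d' : X → X → ℝ) (φ : X → X) : Prop :=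
  ∃ r : ℝ, 0 < r ∧ HolderCondWith d d' φ r

/-- `φ : (X,d) → (X,d')` satisfies a Lipschitz condition. -/
def LipschitzCond {X : Type*} (d d' : X → X → ℝ) (φ : X → X) : Prop :=
  ∃ K : ℝ, 0 < K ∧ ∀ g h : X, d' (φ g) (φ h) ≤ K * d g h

/-- `φ : (X,d) → (X,d')` is uniformly continuous. -/
def UnifCont {X : Type*} (d d' : X → X → ℝ) (φ : X → X) : Prop :=
  ∀ ε : ℝ, 0 < ε → ∃ δ : ℝ, 0 < δ ∧ ∀ g h : X, d g h < δ → d' (φ g) (φ h) < ε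

/-- `φ : (X,d) → (X,d')` is a quasi-isometric embedding. -/
def QIEmbedding {X : Type*} (d d' : X → X → ℝ) (φ : X → X) : Prop :=
  ∃ lam K : ℝ, 1 ≤ lam ∧ 0 ≤ K ∧ ∀ g h : X,
    (1 / lam) * d g h - K ≤ d' (φ g) (φ h) ∧ d' (φ g) (φ h) ≤ lam * d g h + K

/-- `H` is a quasiconvex subset of `G` with respect to the generating set `A`:
every geodesic word-metric chain joining two points of `H` stays at bounded
distance from `H`. -/
def IsQuasiconvex [Group G] (A : Set G) (H : Set G) : Prop :=
  ∃ q : ℝ, 0 ≤ q ∧ ∀ h ∈ H, ∀ h' ∈ H, ∀ n : ℕ, ∀ g : ℕ → G,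
    g 0 = h → g n = h' → (n : ℝ) = wordDist A h h' →
    (∀ i < n, wordDist A (g i) (g (i + 1)) = 1) →
    ∀ i ≤ n, ∃ z ∈ H, wordDist A (g i) z ≤ q

end Defs

section WordMetric

variable {G : Type*} [Group G] {A : Set G}

theorem wordLength_prod_le (w : List G) (hw : ∀ x ∈ w, x ∈ A ∨ x⁻¹ ∈ A) :
    wordLength A w.prod ≤ w.length :=
  Nat.sInf_le ⟨w, rfl, hw, rfl⟩

theorem exists_word_length_eq (hA : Subgroup.closure A = ⊤) (g : G) :
    ∃ w : List G, w.length = wordLength A g ∧ (∀ x ∈ w, x ∈ A ∨ x⁻¹ ∈ A) ∧ w.prod = g := by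
  obtain ⟨w, hw, hg⟩ := Submonoid.exists_list_of_mem_closure
    (show g ∈ Submonoid.closure (A ∪ A⁻¹) by
      rw [← Subgroup.closure_toSubmonoid, hA]; exact Subgroup.mem_top g)
  exact Nat.sInf_mem (s := {n : ℕ | ∃ w : List G, w.length = n ∧
    (∀ x ∈ w, x ∈ A ∨ x⁻¹ ∈ A) ∧ w.prod = g}) ⟨w.length, w, rfl, hw, hg⟩

theorem wordLength_one : wordLength A (1 : G) = 0 := by
  simpa using wordLength_prod_le (A := A) [] (by simp)

theorem wordLength_mul_le (hA : Subgroup.closure A = ⊤) (g h : G) :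
    wordLength A (g * h) ≤ wordLength A g + wordLength A h := by
  obtain ⟨v, hv, hvA, rfl⟩ := exists_word_length_eq hA g
  obtain ⟨w, hw, hwA, rfl⟩ := exists_word_length_eq hA h
  rw [← hv, ← hw, ← List.prod_append, ← List.length_append]
  refine wordLength_prod_le _ fun x hx => ?_
  rcases List.mem_append.1 hx with hx | hx
  exacts [hvA x hx, hwA x hx]

theorem wordLength_inv_le (hA : Subgroup.closure A = ⊤) (g : G) :
    wordLength A g⁻¹ ≤ wordLength A g := by
  obtain ⟨w, hw, hwA, rfl⟩ := exists_word_length_eq hA g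
  rw [← hw, List.prod_inv_reverse]
  refine (wordLength_prod_le _ fun x hx => ?_).trans (by simp)
  simp only [List.mem_reverse, List.mem_map] at hx
  obtain ⟨y, hy, rfl⟩ := hx
  simpa using (hwA y hy).symm

theorem wordLength_inv (hA : Subgroup.closure A = ⊤) (g : G) :
    wordLength A g⁻¹ = wordLength A g :=
  (wordLength_inv_le hA g).antisymm (by simpa using wordLength_inv_le hA g⁻¹)

theorem exists_mul_eq_of_wordLength_le (hA : Subgroup.closure A = ⊤) {g : G} {m n : ℕ}
    (hg : wordLength A g ≤ m + n) :
    ∃ h k : G, wordLength A h ≤ m ∧ wordLength A k ≤ n ∧ h * k = g := by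
  obtain ⟨w, hw, hwA, rfl⟩ := exists_word_length_eq hA g
  refine ⟨(w.take m).prod, (w.drop m).prod, ?_, ?_, List.prod_take_mul_prod_drop w m⟩
  · exact (wordLength_prod_le _ fun x hx => hwA x (List.mem_of_mem_take hx)).trans
      (List.length_take_le _ _)
  · refine (wordLength_prod_le _ fun x hx => hwA x (List.mem_of_mem_drop hx)).trans ?_
    rw [List.length_drop]
    omega

theorem finite_setOf_wordLength_le (hfin : A.Finite) (hA : Subgroup.closure A = ⊤) (n : ℕ) :
    {g : G | wordLength A g ≤ n}.Finite := by
  have h_one : {g : G | wordLength A g ≤ 1}.Finite := by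
    refine ((hfin.union hfin.inv).insert 1).subset fun g hg => ?_
    obtain ⟨w, hw, hwA, rfl⟩ := exists_word_length_eq hA g
    have hg : w.length ≤ 1 := hw.trans_le hg
    match w, hg with
    | [], _ => simp
    | [x], _ => simpa using Or.inr (hwA x (by simp))
  induction n with
  | zero => exact h_one.subset fun g hg => (show wordLength A g ≤ 0 from hg).trans zero_le_one
  | succ n ih =>
    refine (ih.image2 (· * ·) h_one).subset fun g hg => ?_
    obtain ⟨h, k, hh, hk, rfl⟩ := exists_mul_eq_of_wordLength_le hA hg
    exact ⟨h, hh, k, hk, rfl⟩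

theorem wordDist_nonneg (g h : G) : 0 ≤ wordDist A g h := Nat.cast_nonneg _

theorem wordDist_self (g : G) : wordDist A g g = 0 := by
  simp [wordDist, wordLength_one]

theorem wordDist_comm (hA : Subgroup.closure A = ⊤) (g h : G) :
    wordDist A g h = wordDist A h g := by
  rw [wordDist, ← wordLength_inv hA]
  simp [wordDist]

theorem wordDist_triangle (hA : Subgroup.closure A = ⊤) (g h k : G) :
    wordDist A g k ≤ wordDist A g h + wordDist A h k := by
  have := wordLength_mul_le hA (g⁻¹ * h) (h⁻¹ * k)
  rw [show g⁻¹ * h * (h⁻¹ * k) = g⁻¹ * k by group] at this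
  unfold wordDist
  exact_mod_cast this

theorem wordDist_le_sub_of_step_le (hA : Subgroup.closure A = ⊤) {g : ℕ → G} {n : ℕ}
    (hg : ∀ i < n, wordDist A (g i) (g (i + 1)) = 1) {i j : ℕ} (hij : i ≤ j) (hj : j ≤ n) :
    wordDist A (g i) (g j) ≤ (j : ℝ) - i := by
  induction j, hij using Nat.le_induction with
  | base => simp [wordDist_self]
  | succ j hij ih =>
    have h₁ := ih (by omega)
    have h₂ := hg j (by omega)
    have h₃ := wordDist_triangle hA (g i) (g j) (g (j + 1))
    push_cast
    linarith

theorem wordDist_eq_sub_of_geodesic (hA : Subgroup.closure A = ⊤) {g : ℕ → G} {n : ℕ}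
    (hn : (n : ℝ) = wordDist A (g 0) (g n))
    (hg : ∀ i < n, wordDist A (g i) (g (i + 1)) = 1) {i j : ℕ} (hij : i ≤ j) (hj : j ≤ n) :
    wordDist A (g i) (g j) = (j : ℝ) - i := by
  have h₁ := wordDist_le_sub_of_step_le hA hg hij hj
  have h₂ := wordDist_le_sub_of_step_le hA hg (Nat.zero_le i) (hij.trans hj)
  have h₃ := wordDist_le_sub_of_step_le hA hg hj le_rfl
  have h₄ := wordDist_triangle hA (g 0) (g i) (g n)
  have h₅ := wordDist_triangle hA (g i) (g j) (g n)
  push_cast at h₂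
  linarith

/-- Images of points at distance at most `2 ^ k` have large Gromov product at `x` if the image of
`φ` stays far from `x`: Gromov products decay only logarithmically along a path. -/
theorem le_gromov_map_of_wordLength_le_two_pow (hA : Subgroup.closure A = ⊤) {δ : ℝ}
    (hδ : IsHyperbolicWith A δ) (φ : G →* G) {L D : ℝ} (hL : 0 ≤ L)
    (hφ : ∀ g : G, wordLength A g ≤ 1 → (wordLength A (φ g) : ℝ) ≤ L) {x : G}
    (hx : ∀ g, D ≤ wordDist A x (φ g)) (k : ℕ) (u v : G) (huv : wordLength A (u⁻¹ * v) ≤ 2 ^ k) :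
    D - L - k * δ ≤ gromov (wordDist A) x (φ u) (φ v) := by
  induction k generalizing u v with
  | zero =>
    have h := hφ _ huv
    rw [map_mul, map_inv] at h
    change wordDist A (φ u) (φ v) ≤ L at h
    have h₁ := hx u
    have h₂ := hx v
    unfold gromov
    push_cast
    linarith
  | succ k ih =>
    obtain ⟨a, b, ha, hb, hab⟩ := exists_mul_eq_of_wordLength_le hA
      (show wordLength A (u⁻¹ * v) ≤ 2 ^ k + 2 ^ k by rwa [← two_mul, ← pow_succ'])
    have h₁ := ih u (u * a) (by simpa using ha)
    have h₂ := ih (u * a) v (by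
      rwa [show (u * a)⁻¹ * v = b by rw [mul_inv_rev, mul_assoc, ← hab]; group])
    have h₃ := hδ x (φ u) (φ (u * a)) (φ v)
    have h₄ := le_min h₁ h₂
    push_cast
    linarith

end WordMetric

/-- A quantity `D` that grows at most logarithmically in itself is bounded. -/
theorem exists_bound_of_forall_le_two_pow {r : ℝ} (hr : 0 < r) (C L : ℝ) {δ : ℝ} (hδ : 0 ≤ δ) :
    ∃ q : ℝ, 0 ≤ q ∧ ∀ D : ℝ,
      (∀ k : ℕ, 6 * D + C ≤ r * 2 ^ k → D ≤ L + (k + 2) * δ) → D ≤ q := by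
  have h_lim : Filter.Tendsto
      (fun k : ℕ => (6 * δ) * ((k : ℝ) ^ 1 / 2 ^ k) + (6 * L + 18 * δ + C) * ((k : ℝ) ^ 0 / 2 ^ k))
      Filter.atTop (nhds 0) := by
    simpa using ((tendsto_pow_const_div_const_pow_of_one_lt 1 (one_lt_two (α := ℝ))).const_mul
      (6 * δ)).add ((tendsto_pow_const_div_const_pow_of_one_lt 0 (one_lt_two (α := ℝ))).const_mul
      (6 * L + 18 * δ + C))
  obtain ⟨k₀, hk₀⟩ := Filter.eventually_atTop.1 (h_lim.eventually_lt_const hr)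
  refine ⟨max 0 (L + (k₀ + 2) * δ), le_max_left _ _, fun D hD => ?_⟩
  have h_ex : ∃ k : ℕ, 6 * D + C ≤ r * 2 ^ k := by
    obtain ⟨k, hk⟩ := pow_unbounded_of_one_lt ((6 * D + C) / r) (one_lt_two (α := ℝ))
    exact ⟨k, ((div_lt_iff₀' hr).1 hk).le⟩
  obtain ⟨k, hk, h_min⟩ : ∃ k : ℕ, 6 * D + C ≤ r * 2 ^ k ∧ ∀ j < k, ¬ 6 * D + C ≤ r * 2 ^ j :=
    ⟨Nat.find h_ex, Nat.find_spec h_ex, fun j hj => Nat.find_min h_ex hj⟩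
  rcases le_or_gt k k₀ with hkk | hkk
  · refine le_max_of_le_right ((hD k hk).trans ?_)
    gcongr
  · obtain ⟨j, rfl⟩ : ∃ j, k = j + 1 := ⟨k - 1, by omega⟩
    have h₁ := not_le.1 (h_min j (Nat.lt_succ_self j))
    have h₂ := hk₀ j (by omega)
    have h₃ := hD _ hk
    have h_pos : (0 : ℝ) < 2 ^ j := by positivity
    have h₄ : (6 * δ * j + (6 * L + 18 * δ + C)) / 2 ^ j < r := by
      rw [pow_one, pow_zero] at h₂
      rw [add_div, mul_div_assoc, div_eq_mul_one_div (_ + C)]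
      exact h₂
    rw [div_lt_iff₀ h_pos] at h₄
    push_cast at h₃
    linarith

section Quasiconvex

variable {G : Type*} [Group G] {A : Set G}

theorem isQuasiconvex_range_of_le_wordLength_map (hA : Subgroup.closure A = ⊤) {δ : ℝ}
    (hδ_nonneg : 0 ≤ δ) (hδ : IsHyperbolicWith A δ) (φ : G →* G) {r C L : ℝ} (hr : 0 < r)
    (hL : 0 ≤ L) (hφ : ∀ g : G, wordLength A g ≤ 1 → (wordLength A (φ g) : ℝ) ≤ L)
    (h_low : ∀ g : G, r * wordLength A g ≤ wordLength A (φ g) + C) :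
    IsQuasiconvex A (Set.range φ) := by
  obtain ⟨q, hq, hbound⟩ := exists_bound_of_forall_le_two_pow hr C L hδ_nonneg
  refine ⟨q, hq, fun h hh h' hh' n g hg0 hgn hn hstep => ?_⟩
  subst hg0 hgn
  have h_geod : ∀ {i j : ℕ}, i ≤ j → j ≤ n → wordDist A (g i) (g j) = (j : ℝ) - i :=
    fun hij hj => wordDist_eq_sub_of_geodesic hA hn hstep hij hj
  let f : ℕ → ℕ := fun i => sInf (Set.range fun u => wordLength A ((g i)⁻¹ * φ u))
  have f_le : ∀ i u, (f i : ℝ) ≤ wordDist A (g i) (φ u) :=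
    fun i u => Nat.cast_le.2 (Nat.sInf_le ⟨u, rfl⟩)
  have f_eq : ∀ i, ∃ u, wordDist A (g i) (φ u) = f i := fun i => by
    obtain ⟨u, hu⟩ := Nat.sInf_mem (Set.range_nonempty fun u => wordLength A ((g i)⁻¹ * φ u))
    exact ⟨u, congrArg Nat.cast hu⟩
  obtain ⟨i, hi, h_max⟩ := Finset.exists_max_image (Finset.range (n + 1)) f ⟨0, by simp⟩
  simp only [Finset.mem_range, Nat.lt_succ_iff] at hi h_max
  suffices hD : (f i : ℝ) ≤ q by
    intro j hj
    obtain ⟨u, hu⟩ := f_eq j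
    exact ⟨φ u, ⟨u, rfl⟩, hu.le.trans ((Nat.cast_le.2 (h_max j hj)).trans hD)⟩
  have h_side : ∀ j ≤ n, wordDist A (g i) (g j) = 2 * f i ∨
      (g j ∈ Set.range φ ∧ wordDist A (g i) (g j) ≤ 2 * f i) →
      ∃ u, wordDist A (g i) (φ u) ≤ 3 * f i ∧
        f i ≤ gromov (wordDist A) (g i) (g j) (φ u) := by
    rintro j hj (h_eq | ⟨⟨u, hu⟩, h_le⟩)
    · obtain ⟨u, hu⟩ := f_eq j
      have h₁ : (f j : ℝ) ≤ f i := Nat.cast_le.2 (h_max j hj)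
      have h₂ := wordDist_triangle hA (g i) (g j) (φ u)
      have h₃ := f_le i u
      refine ⟨u, by linarith, ?_⟩
      unfold gromov
      linarith
    · have h₁ := f_le i u
      have h₂ : (0 : ℝ) ≤ f i := Nat.cast_nonneg _
      rw [← hu] at h_le ⊢
      refine ⟨u, by linarith, ?_⟩
      unfold gromov
      rw [wordDist_self]
      linarith
  obtain ⟨j, hji, u, hu, hju⟩ : ∃ j ≤ i, ∃ u, wordDist A (g i) (φ u) ≤ 3 * f i ∧
      f i ≤ gromov (wordDist A) (g i) (g j) (φ u) := by
    rcases le_total (2 * f i) i with hfi | hfi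
    · refine ⟨i - 2 * f i, by omega, h_side _ (by omega) (Or.inl ?_)⟩
      rw [wordDist_comm hA, h_geod (by omega) hi]
      push_cast [hfi]
      ring
    · refine ⟨0, by omega, h_side _ (by omega) (Or.inr ⟨hh, ?_⟩)⟩
      rw [wordDist_comm hA, h_geod (by omega) hi]
      simpa using (by exact_mod_cast hfi : (i : ℝ) ≤ 2 * f i)
  obtain ⟨k, hik, hkn, v, hv, hkv⟩ : ∃ k, i ≤ k ∧ k ≤ n ∧ ∃ v, wordDist A (g i) (φ v) ≤ 3 * f i ∧
      f i ≤ gromov (wordDist A) (g i) (g k) (φ v) := by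
    rcases le_total (i + 2 * f i) n with hfi | hfi
    · refine ⟨i + 2 * f i, by omega, hfi, h_side _ hfi (Or.inl ?_)⟩
      rw [h_geod (by omega) hfi]
      push_cast
      ring
    · refine ⟨n, hi, le_rfl, h_side _ le_rfl (Or.inr ⟨hh', ?_⟩)⟩
      rw [h_geod hi le_rfl]
      have : (n : ℝ) ≤ i + 2 * f i := by exact_mod_cast hfi
      linarith
  refine hbound _ fun m hm => ?_
  have h_uv : wordLength A (u⁻¹ * v) ≤ 2 ^ m := by
    have h₁ := h_low (u⁻¹ * v)
    rw [map_mul, map_inv] at h₁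
    have h₂ := wordDist_triangle hA (φ u) (g i) (φ v)
    rw [wordDist_comm hA (φ u) (g i)] at h₂
    change _ ≤ wordDist A (φ u) (φ v) + C at h₁
    have h₃ : r * (wordLength A (u⁻¹ * v) : ℝ) ≤ r * 2 ^ m := by linarith
    exact_mod_cast le_of_mul_le_mul_left h₃ hr
  have h₁ := le_gromov_map_of_wordLength_le_two_pow hA hδ φ hL hφ (f_le i) m u v h_uv
  have h₂ : gromov (wordDist A) (g i) (g j) (g k) = 0 := by
    rw [gromov, wordDist_comm hA (g i) (g j), h_geod hji hi, h_geod hik hkn,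
      h_geod (hji.trans hik) hkn]
    ring
  have h₃ := hδ (g i) (g j) (φ u) (g k)
  have h₄ := hδ (g i) (φ u) (φ v) (g k)
  have h₅ : gromov (wordDist A) (g i) (φ v) (g k) = gromov (wordDist A) (g i) (g k) (φ v) := by
    rw [gromov, gromov, wordDist_comm hA (φ v) (g k)]
    ring
  have hmδ : 0 ≤ (m : ℝ) * δ := by positivity
  have h₆ : f i - L - m * δ ≤ min (gromov (wordDist A) (g i) (φ u) (φ v))
      (gromov (wordDist A) (g i) (φ v) (g k)) := le_min h₁ (by linarith)
  have h₇ : f i - L - m * δ - δ ≤ min (gromov (wordDist A) (g i) (g j) (φ u))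
      (gromov (wordDist A) (g i) (φ u) (g k)) := le_min (by linarith) (by linarith)
  linarith

/-- A Hölder condition forces linear growth of `φ`: compare `g` with `g * a` where `φ a ≠ 1`. -/
theorem exists_mul_wordLength_le_wordLength_map_add (hA : Subgroup.closure A = ⊤) {p : G}
    {γ T : ℝ} (hγ : 0 < γ) (hT : 1 ≤ T) {d : G → G → ℝ} (hd : InVisual A p γ T d) (φ : G →* G)
    (hnt : ∃ g : G, φ g ≠ 1) (hhold : SatisfiesHolder d d φ) :
    ∃ r C : ℝ, 0 < r ∧ ∀ g : G, r * wordLength A g ≤ wordLength A (φ g) + C := by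
  obtain ⟨a, ha⟩ := hnt
  obtain ⟨r, hr, K, hK, hφ⟩ := hhold
  have hT_pos : 0 < T := zero_lt_one.trans_le hT
  have length_eq : ∀ g : G, (wordLength A g : ℝ) = wordDist A 1 g := fun g => by simp [wordDist]
  refine ⟨r, (1 / γ) * Real.log (T * K * T ^ r) + wordDist A p 1 + r * (wordDist A p 1 +
    wordLength A a), hr, fun g => ?_⟩
  have h_ne : φ g ≠ φ (g * a) := by simpa [eq_comm] using ha
  have h_ne' : g ≠ g * a := fun h => h_ne (congrArg φ h)
  have h_lower := (hd.2 _ _ h_ne).1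
  have h_upper := (hd.2 _ _ h_ne').2
  rw [visualRhoOf, if_neg h_ne, div_le_iff₀ hT_pos] at h_lower
  rw [visualRhoOf, if_neg h_ne'] at h_upper
  have hd_nonneg : 0 ≤ d g (g * a) := by
    refine le_trans ?_ (hd.2 _ _ h_ne').1
    rw [visualRhoOf, if_neg h_ne']
    positivity
  set s := gromov (wordDist A) p g (g * a) with hs
  set t := gromov (wordDist A) p (φ g) (φ (g * a)) with ht
  have h_exp : Real.exp (-γ * t) ≤ T * K * T ^ r * Real.exp (-γ * s * r) := by
    calc Real.exp (-γ * t) ≤ d (φ g) (φ (g * a)) * T := h_lower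
      _ ≤ K * (T * Real.exp (-γ * s)) ^ r * T := by
        gcongr
        exact (hφ _ _).trans (by gcongr)
      _ = T * K * T ^ r * Real.exp (-γ * s * r) := by
        rw [Real.mul_rpow hT_pos.le (Real.exp_pos _).le, ← Real.exp_mul]
        ring
  have h_pos : 0 < T * K * T ^ r := by positivity
  have h_log := Real.log_le_log (Real.exp_pos _) h_exp
  rw [Real.log_mul h_pos.ne' (Real.exp_pos _).ne', Real.log_exp, Real.log_exp] at h_log
  have h_st : r * s ≤ t + (1 / γ) * Real.log (T * K * T ^ r) := by
    refine le_of_mul_le_mul_left ?_ hγ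
    have : γ * (t + 1 / γ * Real.log (T * K * T ^ r)) = γ * t + Real.log (T * K * T ^ r) := by
      field_simp
    linarith
  have h_ga : wordDist A g (g * a) = wordLength A a := by simp [wordDist]
  have h_s : (wordLength A g : ℝ) - wordDist A p 1 - wordLength A a ≤ s := by
    have h₁ := wordDist_triangle hA 1 p g
    have h₂ := wordDist_triangle hA p (g * a) g
    rw [wordDist_comm hA (g * a) g] at h₂
    rw [wordDist_comm hA 1 p] at h₁
    rw [hs, gromov, length_eq g]
    linarith [wordDist_nonneg (A := A) 1 a]
  have h_t : t ≤ wordLength A (φ g) + wordDist A p 1 := by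
    have h₁ := wordDist_triangle hA p 1 (φ g)
    have h₂ := wordDist_triangle hA p (φ g) (φ (g * a))
    rw [ht, gromov, length_eq (φ g)]
    linarith
  have := mul_le_mul_of_nonneg_left h_s hr.le
  linarith

end Quasiconvex

/-- If a nontrivial endomorphism of a hyperbolic group satisfies a Hölder
condition with respect to a visual metric, then its kernel is finite and its image is a
quasiconvex subgroup. -/
theorem stmt_7 {G : Type*} [Group G] (A : Set G)
    (hAfin : A.Finite) (hAgen : Subgroup.closure A = ⊤) (hhyp : IsHyperbolic A)
    (p : G) (γ T : ℝ) (hγ : 0 < γ) (hT : 1 ≤ T)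
    (d : G → G → ℝ) (hd : InVisual A p γ T d)
    (φ : G →* G) (hnt : ∃ g : G, φ g ≠ 1)
    (hhold : SatisfiesHolder d d ⇑φ) :
    {g : G | φ g = 1}.Finite ∧ IsQuasiconvex A (Set.range ⇑φ) := by
  obtain ⟨δ, hδ_nonneg, hδ⟩ := hhyp
  obtain ⟨r, C, hr, h_low⟩ :=
    exists_mul_wordLength_le_wordLength_map_add hAgen hγ hT hd φ hnt hhold
  refine ⟨(finite_setOf_wordLength_le hAfin hAgen ⌊C / r⌋₊).subset fun g hg => ?_, ?_⟩
  · have h := h_low g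
    rw [show φ g = 1 from hg, wordLength_one, Nat.cast_zero, zero_add] at h
    exact Nat.le_floor ((le_div_iff₀' hr).2 h)
  · obtain ⟨L, hL⟩ := ((finite_setOf_wordLength_le hAfin hAgen 1).image
      fun g => wordLength A (φ g)).bddAbove
    exact isQuasiconvex_range_of_le_wordLength_map hAgen hδ_nonneg hδ φ hr (Nat.cast_nonneg L)
      (fun g hg => Nat.cast_le.2 (hL ⟨g, hg, rfl⟩)) h_low
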